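/- Let n_1,…,n_m ∈ ℝ^n, let Δ = Δ(k⁰) be a Delzant polytope, and let b ∈ ℝ^n. Then there exists a real polynomial Q in m variables, homogeneous of degree n+1, such that ∫_{Δ(k)} ⟨x, b⟩ dx = Q(k_1,…,k_m) for every k ∈ C_Δ, the integral being with respect to Lebesgue measure on ℝ^n. -/

import Mathlib

open MeasureTheory

noncomputable section

/-- Euclidean inner product on ℝⁿ. -/
def dot {n : ℕ} (x y : Fin n → ℝ) : ℝ := ∑ i, x i * y i

/-- The polytope `Δ(k) = ⋂_j {x : ⟨x, n_j⟩ ≤ k_j}` determined by conormals `N` and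
support numbers `k`. -/
def PolyDelta {n m : ℕ} (N : Fin m → Fin n → ℝ) (k : Fin m → ℝ) : Set (Fin n → ℝ) :=
  {x | ∀ j, dot x (N j) ≤ k j}

/-- The facet `F_j(k) = Δ(k) ∩ {x : ⟨x, n_j⟩ = k_j}`. -/
def PolyFacet {n m : ℕ} (N : Fin m → Fin n → ℝ) (k : Fin m → ℝ) (j : Fin m) :
    Set (Fin n → ℝ) :=
  {x ∈ PolyDelta N k | dot x (N j) = k j}

/-- The chamber of the polytope `Δ(k⁰)`: those `k` for which the combinatorics of the
facets of `Δ(k)` agrees with that of `Δ(k⁰)`. -/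
def chamber {n m : ℕ} (N : Fin m → Fin n → ℝ) (k0 : Fin m → ℝ) : Set (Fin m → ℝ) :=
  {k | ∀ J : Finset (Fin m),
    (⋂ j ∈ J, PolyFacet N k j).Nonempty ↔ (⋂ j ∈ J, PolyFacet N k0 j).Nonempty}

/-- Center of mass of a subset of ℝⁿ: `Cm(K) = (∫_K x dx)/(∫_K 1 dx)`. -/
def Cm {n : ℕ} (K : Set (Fin n → ℝ)) : Fin n → ℝ :=
  (∫ x in K, (1 : ℝ))⁻¹ • ∫ x in K, x

/-- `(Δ(k⁰), b)` is a mass linear pair: `⟨Cm(Δ(k)), b⟩` is an (affine) linear function of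
`k` on the chamber of `Δ(k⁰)`. -/
def IsMassLinear {n m : ℕ} (N : Fin m → Fin n → ℝ) (k0 : Fin m → ℝ) (b : Fin n → ℝ) :
    Prop :=
  ∃ (R : Fin m → ℝ) (C : ℝ), ∀ k ∈ chamber N k0,
    dot (Cm (PolyDelta N k)) b = (∑ j, R j * k j) + C

/-- `Δ(k)` is a Delzant polytope: each conormal is a primitive integer vector, exactly `n`
facets meet at each vertex, and the conormals of the facets through any vertex form a
ℤ-basis of ℤⁿ (an integer matrix of determinant ±1). -/
def IsDelzant {n m : ℕ} (N : Fin m → Fin n → ℝ) (k : Fin m → ℝ) : Prop :=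
  (∀ j, ∃ z : Fin n → ℤ, (∀ i, N j i = (z i : ℝ)) ∧ Finset.univ.gcd z = 1) ∧
  ∀ v ∈ Set.extremePoints ℝ (PolyDelta N k),
    ∃ J : Finset (Fin m), J.card = n ∧ (∀ j, j ∈ J ↔ dot v (N j) = k j) ∧
      ∃ e : Fin n → Fin m, (∀ i, e i ∈ J) ∧ Function.Injective e ∧
        |(Matrix.of fun i i' => N (e i) i').det| = 1

lemma dot_add_left' {n : ℕ} (x y z : Fin n → ℝ) : dot (x + y) z = dot x z + dot y z := by
  simp [dot, add_mul, Finset.sum_add_distrib]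

lemma dot_smul_left' {n : ℕ} (c : ℝ) (x z : Fin n → ℝ) : dot (c • x) z = c * dot x z := by
  simp [dot, Finset.mul_sum, mul_assoc]

lemma dot_add_right' {n : ℕ} (x y z : Fin n → ℝ) : dot x (y + z) = dot x y + dot x z := by
  simp [dot, mul_add, Finset.sum_add_distrib]

lemma dot_smul_right' {n : ℕ} (c : ℝ) (x z : Fin n → ℝ) : dot x (c • z) = c * dot x z := by
  simp only [dot, Finset.mul_sum, Pi.smul_apply, smul_eq_mul]
  exact Finset.sum_congr rfl fun i _ => by ring

lemma dot_sum_left' {n : ℕ} {ι : Type*} (s : Finset ι) (f : ι → Fin n → ℝ) (z : Fin n → ℝ) :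
    dot (∑ j ∈ s, f j) z = ∑ j ∈ s, dot (f j) z := by
  simp only [dot, Finset.sum_apply, Finset.sum_mul]
  exact Finset.sum_comm

lemma continuous_dot' {n : ℕ} (z : Fin n → ℝ) : Continuous fun x => dot x z := by
  unfold dot; fun_prop

/-- combinatorial data of a simple polytope -/
structure Good {n m : ℕ} (N : Fin m → Fin n → ℝ) (V : Finset (Finset (Fin m)))
    (u : Finset (Fin m) → Fin m → Fin n → ℝ) (k : Fin m → ℝ) : Prop where
  h1 : ∀ J ∈ V, ∀ i ∈ J, ∀ j ∈ J, dot (u J i) (N j) = if i = j then 1 else 0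
  h2 : ∀ J ∈ V, ∀ x : Fin n → ℝ, x = ∑ j ∈ J, dot x (N j) • u J j
  h3 : ∀ J ∈ V, J.card = n
  h4 : ∀ x ∈ PolyDelta N k, ∃ J ∈ V, ∀ j, dot x (N j) = k j → j ∈ J
  h5 : ∀ J ∈ V, (∑ j ∈ J, k j • u J j) ∈ PolyDelta N k
  hc : IsCompact (PolyDelta N k)

/-- genericity of a covector -/
def Generic {n m : ℕ} (V : Finset (Finset (Fin m)))
    (u : Finset (Fin m) → Fin m → Fin n → ℝ) (ξ : Fin n → ℝ) : Prop :=
  ∀ J ∈ V, ∀ j ∈ J, dot (u J j) ξ ≠ 0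

/-- vertex -/
def vert {n m : ℕ} (u : Finset (Fin m) → Fin m → Fin n → ℝ) (k : Fin m → ℝ)
    (J : Finset (Fin m)) : Fin n → ℝ := ∑ j ∈ J, k j • u J j

section
variable {n m : ℕ} {N : Fin m → Fin n → ℝ} {V : Finset (Finset (Fin m))}
    {u : Finset (Fin m) → Fin m → Fin n → ℝ} {k : Fin m → ℝ} {ξ : Fin n → ℝ}

lemma Good.vert_tight (h : Good N V u k) {J} (hJ : J ∈ V) {j} (hj : j ∈ J) :
    dot (vert u k J) (N j) = k j := by
  unfold vert
  rw [dot_sum_left']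
  rw [Finset.sum_eq_single j]
  · rw [dot_smul_left', h.h1 J hJ j hj j hj]; simp
  · intro i hi hij
    rw [dot_smul_left', h.h1 J hJ i hi j hj]; simp [hij]
  · intro h; exact absurd hj h

lemma Good.dot_eq (h : Good N V u k) {J} (hJ : J ∈ V) (x ξ : Fin n → ℝ) :
    dot x ξ = ∑ j ∈ J, dot x (N j) * dot (u J j) ξ := by
  conv_lhs => rw [h.h2 J hJ x]
  rw [dot_sum_left']
  simp only [dot_smul_left']

lemma Good.dot_sub (h : Good N V u k) {J} (hJ : J ∈ V) (x ξ : Fin n → ℝ) :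
    dot x ξ = dot (vert u k J) ξ + ∑ j ∈ J, (dot x (N j) - k j) * dot (u J j) ξ := by
  rw [h.dot_eq hJ x ξ, vert, dot_sum_left', ← Finset.sum_add_distrib]
  exact Finset.sum_congr rfl fun j _ => by rw [dot_smul_left']; ring

lemma Good.eq_of_tight (h : Good N V u k) {J J'} (hJ : J ∈ V) (hJ' : J' ∈ V)
    (ht : ∀ j ∈ J', dot (vert u k J) (N j) = k j) : J = J' := by
  obtain ⟨K, hK, hK2⟩ := h.h4 _ (h.h5 J hJ)
  have e1 : J = K := Finset.eq_of_subset_of_card_le (fun j hj => hK2 j (h.vert_tight hJ hj))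
    (by rw [h.h3 _ hJ, h.h3 _ hK])
  have e2 : J' = K := Finset.eq_of_subset_of_card_le (fun j hj => hK2 j (ht j hj))
    (by rw [h.h3 _ hJ', h.h3 _ hK])
  rw [e1, e2]

/-- moving from a point of a face into the polytope along an edge direction -/
lemma Good.move (h : Good N V u k) {J} (hJ : J ∈ V) {x} (hx : x ∈ PolyDelta N k)
    (ht : ∀ j, dot x (N j) = k j → j ∈ J) {i} (hi : i ∈ J) :
    ∃ ε : ℝ, 0 < ε ∧ x + (-ε) • u J i ∈ PolyDelta N k := by
  have key : ∀ j, ∀ᶠ ε in nhdsWithin (0:ℝ) (Set.Ioi 0), dot (x + (-ε) • u J i) (N j) ≤ k j := by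
    intro j
    simp only [dot_add_left', dot_smul_left']
    by_cases hj : j ∈ J
    · rw [h.h1 J hJ i hi j hj]
      filter_upwards [self_mem_nhdsWithin] with ε hε
      have := hx j
      have hε : 0 < ε := hε
      split_ifs <;> linarith
    · have hlt : dot x (N j) < k j := lt_of_le_of_ne (hx j) (fun e => hj (ht j e))
      have hcont : Continuous fun ε : ℝ => dot x (N j) + -ε * dot (u J i) (N j) := by fun_prop
      have : ∀ᶠ ε in nhds (0:ℝ), dot x (N j) + -ε * dot (u J i) (N j) < k j :=
        hcont.continuousAt.eventually_lt continuousAt_const (by simpa using hlt)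
      have this2 : ∀ᶠ ε in nhdsWithin (0:ℝ) (Set.Ioi 0),
          dot x (N j) + -ε * dot (u J i) (N j) < k j := nhdsWithin_le_nhds this
      exact this2.mono fun ε h => le_of_lt h
  obtain ⟨ε, h1, h2⟩ := ((Filter.eventually_all.2 key).and self_mem_nhdsWithin).exists
  exact ⟨ε, h2, h1⟩

lemma Good.min_on_face (h : Good N V u k) {S J : Finset (Fin m)} (hJ : J ∈ V)
    (hneg : ∀ j ∈ J \ S, dot (u J j) ξ < 0) {x} (hx : x ∈ PolyDelta N k)
    (hxS : ∀ j ∈ S, dot x (N j) = k j) :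
    dot (vert u k J) ξ ≤ dot x ξ ∧
      (dot x ξ ≤ dot (vert u k J) ξ → ∀ j ∈ J, dot x (N j) = k j) := by
  have hnn : ∀ j ∈ J, 0 ≤ (dot x (N j) - k j) * dot (u J j) ξ := by
    intro j hj
    by_cases hjS : j ∈ S
    · simp [hxS j hjS]
    · have := hneg j (by simp [hj, hjS])
      have := hx j
      nlinarith
  have e := h.dot_sub hJ x ξ
  refine ⟨by linarith [Finset.sum_nonneg hnn], fun hle j hj => ?_⟩
  have h0 : ∑ j ∈ J, (dot x (N j) - k j) * dot (u J j) ξ = 0 :=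
    le_antisymm (by linarith) (Finset.sum_nonneg hnn)
  have := (Finset.sum_eq_zero_iff_of_nonneg hnn).1 h0 j hj
  by_cases hjS : j ∈ S
  · exact hxS j hjS
  · have h3 := hneg j (by simp [hj, hjS])
    rcases mul_eq_zero.1 this with h4 | h4
    · linarith
    · exact absurd h4 h3.ne

lemma Good.exists_unique_vertex (h : Good N V u k) (hξ : Generic V u ξ) {S : Finset (Fin m)}
    (hS : ∃ J ∈ V, S ⊆ J) :
    ∃ J ∈ V, (S ⊆ J ∧ ∀ j ∈ J \ S, dot (u J j) ξ < 0) ∧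
      ∀ J' ∈ V, (S ⊆ J' ∧ ∀ j ∈ J' \ S, dot (u J' j) ξ < 0) → J' = J := by
  obtain ⟨J0, hJ0, hSJ0⟩ := hS
  let F : Set (Fin n → ℝ) := PolyDelta N k ∩ {x | ∀ j ∈ S, dot x (N j) = k j}
  have hFc : IsCompact F := by
    apply h.hc.inter_right
    simp only [Set.ofPred_forall]
    exact isClosed_iInter fun j => isClosed_iInter fun _ =>
      isClosed_eq (continuous_dot' _) continuous_const
  have hFn : F.Nonempty := ⟨vert u k J0, h.h5 J0 hJ0, fun j hj => h.vert_tight hJ0 (hSJ0 hj)⟩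
  obtain ⟨x, hxF, hmin⟩ := hFc.exists_isMinOn hFn (continuous_dot' ξ).continuousOn
  obtain ⟨J, hJ, hT⟩ := h.h4 x hxF.1
  have hSJ : S ⊆ J := fun j hj => hT j (hxF.2 j hj)
  have hneg : ∀ j ∈ J \ S, dot (u J j) ξ < 0 := by
    intro i hi
    rw [Finset.mem_sdiff] at hi
    obtain ⟨ε, hε, hmem⟩ := h.move hJ hxF.1 hT hi.1
    have hmemF : x + (-ε) • u J i ∈ F := by
      refine ⟨hmem, fun j hj => ?_⟩
      rw [dot_add_left', dot_smul_left', h.h1 J hJ i hi.1 j (hSJ hj), hxF.2 j hj]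
      have : i ≠ j := fun e => hi.2 (e ▸ hj)
      simp [this]
    have h5 : dot x ξ ≤ dot (x + (-ε) • u J i) ξ := hmin hmemF
    rw [dot_add_left', dot_smul_left'] at h5
    have h6 := hξ J hJ i hi.1
    refine lt_of_le_of_ne ?_ h6
    by_contra hcon
    push Not at hcon
    nlinarith
  refine ⟨J, hJ, ⟨hSJ, hneg⟩, fun J' hJ' ⟨hSJ', hneg'⟩ => ?_⟩
  have a := h.min_on_face hJ hneg (h.h5 J' hJ') (fun j hj => h.vert_tight hJ' (hSJ' hj))
  have b := h.min_on_face hJ' hneg' (h.h5 J hJ) (fun j hj => h.vert_tight hJ (hSJ hj))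
  exact h.eq_of_tight hJ' hJ (a.2 b.1)

/-- signed indicator term -/
def term (N : Fin m → Fin n → ℝ) (u : Finset (Fin m) → Fin m → Fin n → ℝ) (k : Fin m → ℝ)
    (ξ : Fin n → ℝ) (x : Fin n → ℝ) (J : Finset (Fin m)) : ℝ :=
  ∏ j ∈ J, ((if dot x (N j) ≤ k j then (1:ℝ) else 0) + (if dot (u J j) ξ < 0 then (-1:ℝ) else 0))

open Classical in
lemma Good.sum_term (h : Good N V u k) (hξ : Generic V u ξ) (x : Fin n → ℝ) :
    ∑ J ∈ V, term N u k ξ x J = ∑ S : Finset (Fin m), if ∃ J ∈ V, S ⊆ J then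
      (∏ j ∈ S, if dot x (N j) ≤ k j then (1:ℝ) else 0) * (-1) ^ (n - S.card) else 0 := by
  have e1 : ∀ J ∈ V, term N u k ξ x J = ∑ S : Finset (Fin m), if S ⊆ J then
      (∏ j ∈ S, if dot x (N j) ≤ k j then (1:ℝ) else 0) *
        ∏ j ∈ J \ S, (if dot (u J j) ξ < 0 then (-1:ℝ) else 0) else 0 := by
    intro J hJ
    rw [term, Finset.prod_add, ← Finset.sum_filter]
    refine Finset.sum_congr ?_ fun _ _ => rfl
    ext S; simp
  rw [Finset.sum_congr rfl e1, Finset.sum_comm]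
  refine Finset.sum_congr rfl fun S _ => ?_
  split_ifs with hS
  · obtain ⟨J, hJ, ⟨hSJ, hneg⟩, huniq⟩ := h.exists_unique_vertex hξ hS
    rw [Finset.sum_eq_single J]
    · rw [if_pos hSJ]
      congr 1
      rw [Finset.prod_congr rfl (fun j hj => if_pos (hneg j hj)), Finset.prod_const,
        Finset.card_sdiff_of_subset hSJ, h.h3 J hJ]
    · intro J' hJ' hne
      split_ifs with hs
      · have : ∃ j ∈ J' \ S, ¬ dot (u J' j) ξ < 0 := by
          by_contra hcon
          push Not at hcon
          exact hne (huniq J' hJ' ⟨hs, hcon⟩)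
        obtain ⟨j, hj, hj2⟩ := this
        rw [Finset.prod_eq_zero (i := j) hj (if_neg hj2), mul_zero]
      · rfl
    · intro hh; exact absurd hJ hh
  · push Not at hS
    exact Finset.sum_eq_zero fun J hJ => if_neg (hS J hJ)

/-- cone -/
def cone (N : Fin m → Fin n → ℝ) (u : Finset (Fin m) → Fin m → Fin n → ℝ) (k : Fin m → ℝ)
    (ξ : Fin n → ℝ) (J : Finset (Fin m)) : Set (Fin n → ℝ) :=
  {x | ∀ j ∈ J, (dot (u J j) ξ < 0 → k j < dot x (N j)) ∧
    (¬ dot (u J j) ξ < 0 → dot x (N j) ≤ k j)}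

/-- sign -/
def sgn (u : Finset (Fin m) → Fin m → Fin n → ℝ) (ξ : Fin n → ℝ) (J : Finset (Fin m)) : ℝ :=
  ∏ j ∈ J, if dot (u J j) ξ < 0 then (-1 : ℝ) else 1

open Classical in
lemma term_eq (x : Fin n → ℝ) (J : Finset (Fin m)) :
    term N u k ξ x J = if x ∈ cone N u k ξ J then sgn u ξ J else 0 := by
  split_ifs with hx
  · refine Finset.prod_congr rfl fun j hj => ?_
    have := hx j hj
    by_cases hc : dot (u J j) ξ < 0
    · simp [hc, this.1 hc]
    · simp [hc, this.2 hc]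
  · simp only [cone, Set.mem_ofPred_eq] at hx
    push Not at hx
    obtain ⟨j, hj, hj2⟩ := hx
    refine Finset.prod_eq_zero hj ?_
    by_cases hc : dot (u J j) ξ < 0
    · by_cases hd : dot x (N j) ≤ k j
      · simp [hc, hd]
      · have := hj2 (fun _ => not_le.1 hd)
        exact absurd hc (not_lt.2 this.1)
    · by_cases hd : dot x (N j) ≤ k j
      · have := hj2 (fun h => absurd h hc)
        exact absurd hd (not_le.2 this.2)
      · simp [hc, hd]

lemma Good.cone_le (h : Good N V u k) {J} (hJ : J ∈ V) {x} (hx : x ∈ cone N u k ξ J) :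
    ∀ j ∈ J, (dot x (N j) - k j) * dot (u J j) ξ ≤ 0 := by
  intro j hj
  have := hx j hj
  by_cases hc : dot (u J j) ξ < 0
  · have := this.1 hc; nlinarith
  · have := this.2 hc; push Not at hc; nlinarith

lemma exists_generic (hne : ∀ J ∈ V, ∀ j ∈ J, u J j ≠ 0) :
    ∃ ξ : Fin n → ℝ, Generic V u ξ := by
  let ι := {p : Finset (Fin m) × Fin m // p.1 ∈ V ∧ p.2 ∈ p.1}
  let f : ι → Module.Dual ℝ (Fin n → ℝ) := fun p =>
    { toFun := fun ξ => dot (u p.1.1 p.1.2) ξ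
      map_add' := fun a b => dot_add_right' _ a b
      map_smul' := fun c a => by simp [dot_smul_right'] }
  obtain ⟨ξ, hξ⟩ := Module.Dual.exists_forall_ne_zero_of_forall_exists f (by
    rintro ⟨⟨J, j⟩, hJ, hj⟩
    refine ⟨u J j, ?_⟩
    change dot (u J j) (u J j) ≠ 0
    intro h0
    apply hne J hJ j hj
    simp only [dot] at h0
    rw [Finset.sum_eq_zero_iff_of_nonneg (fun i _ => mul_self_nonneg _)] at h0
    ext i
    simpa using h0 i (Finset.mem_univ i))
  exact ⟨ξ, fun J hJ j hj => hξ ⟨⟨J, j⟩, hJ, hj⟩⟩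

lemma exists_generic_near (hη : ∃ η : Fin n → ℝ, Generic V u η) (ν x : Fin n → ℝ)
    (v : Finset (Fin m) → Fin n → ℝ) (hlt : ∀ J ∈ V, dot (v J) ν < dot x ν) :
    ∃ ξ : Fin n → ℝ, Generic V u ξ ∧ ∀ J ∈ V, dot (v J) ξ < dot x ξ := by
  obtain ⟨η, hη⟩ := hη
  have key1 : ∀ J ∈ V, ∀ j ∈ J, ∀ᶠ ε in nhdsWithin (0:ℝ) (Set.Ioi 0),
      dot (u J j) (ν + ε • η) ≠ 0 := by
    intro J hJ j hj
    simp only [dot_add_right', dot_smul_right']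
    have hd := hη J hJ j hj
    by_cases hc : dot (u J j) ν = 0
    · filter_upwards [self_mem_nhdsWithin] with ε hε
      have hε : 0 < ε := hε
      rw [hc, zero_add]
      exact mul_ne_zero hε.ne' hd
    · have hcont : Continuous fun ε : ℝ => dot (u J j) ν + ε * dot (u J j) η := by fun_prop
      exact nhdsWithin_le_nhds (hcont.continuousAt.eventually_ne (by simpa using hc))
  have key2 : ∀ J ∈ V, ∀ᶠ ε in nhdsWithin (0:ℝ) (Set.Ioi 0),
      dot (v J) (ν + ε • η) < dot x (ν + ε • η) := by
    intro J hJ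
    simp only [dot_add_right', dot_smul_right']
    have hcont : Continuous fun ε : ℝ => dot (v J) ν + ε * dot (v J) η := by fun_prop
    have hcont2 : Continuous fun ε : ℝ => dot x ν + ε * dot x η := by fun_prop
    exact nhdsWithin_le_nhds
      (hcont.continuousAt.eventually_lt hcont2.continuousAt (by simpa using hlt J hJ))
  have k1 := (Finset.eventually_all V).2 fun J hJ => (Finset.eventually_all J).2 (key1 J hJ)
  have k2 := (Finset.eventually_all V).2 key2
  obtain ⟨ε, h1, h2⟩ := (k1.and k2).exists
  exact ⟨_, h1, h2⟩

lemma Good.u_ne (h : Good N V u k) : ∀ J ∈ V, ∀ j ∈ J, u J j ≠ 0 := by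
  intro J hJ j hj h0
  have := h.h1 J hJ j hj j hj
  rw [h0] at this
  simp [dot] at this

lemma Generic.neg (hξ : Generic V u ξ) : Generic V u ((-1 : ℝ) • ξ) := by
  intro J hJ j hj
  rw [dot_smul_right']
  simpa using hξ J hJ j hj

open Classical in
lemma Good.indicator (h : Good N V u k) (hξ : Generic V u ξ) (x : Fin n → ℝ) :
    ∑ J ∈ V, (if x ∈ cone N u k ξ J then sgn u ξ J else 0)
      = if x ∈ PolyDelta N k then 1 else 0 := by
  split_ifs with hx
  · obtain ⟨J1, hJ1, -⟩ := h.h4 x hx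
    obtain ⟨J, hJ, ⟨-, hneg⟩, huniq⟩ :=
      h.exists_unique_vertex (S := ∅) hξ.neg ⟨J1, hJ1, Finset.empty_subset _⟩
    simp only [dot_smul_right', Finset.sdiff_empty, Finset.empty_subset, true_and] at hneg huniq
    rw [Finset.sum_eq_single J]
    · have hpos : ∀ j ∈ J, ¬ dot (u J j) ξ < 0 := fun j hj => by linarith [hneg j hj]
      rw [if_pos]
      · exact Finset.prod_eq_one fun j hj => if_neg (hpos j hj)
      · exact fun j hj => ⟨fun hh => absurd hh (hpos j hj), fun _ => hx j⟩
    · intro J' hJ' hne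
      rw [if_neg]
      intro hc
      refine hne (huniq J' hJ' fun j hj => ?_)
      by_contra hcon
      have h1 := hξ J' hJ' j hj
      have h2 : dot (u J' j) ξ < 0 := lt_of_le_of_ne (by linarith) h1
      exact absurd ((hc j hj).1 h2) (not_lt.2 (hx j))
    · intro hh; exact absurd hJ hh
  · simp only [PolyDelta, Set.mem_ofPred_eq] at hx
    push Not at hx
    obtain ⟨i, hi⟩ := hx
    obtain ⟨ξ', hξ', hlt⟩ := exists_generic_near ⟨ξ, hξ⟩ (N i) x (vert u k)
      (fun J hJ => lt_of_le_of_lt (h.h5 J hJ i) hi)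
    simp only [← term_eq]
    rw [h.sum_term hξ x, ← h.sum_term hξ' x]
    refine Finset.sum_eq_zero fun J hJ => ?_
    rw [term_eq, if_neg]
    intro hc
    have := h.dot_sub hJ x ξ'
    have := hlt J hJ
    have := Finset.sum_nonpos (h.cone_le hJ hc)
    linarith

end

section
variable {n m : ℕ} {N : Fin m → Fin n → ℝ} {V : Finset (Finset (Fin m))}
    {u : Finset (Fin m) → Fin m → Fin n → ℝ} {k : Fin m → ℝ} {ξ : Fin n → ℝ}

/-- truncated cone -/
def tcone (N : Fin m → Fin n → ℝ) (u : Finset (Fin m) → Fin m → Fin n → ℝ) (k : Fin m → ℝ)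
    (ξ : Fin n → ℝ) (J : Finset (Fin m)) (M : ℝ) : Set (Fin n → ℝ) :=
  cone N u k ξ J ∩ {x | -M ≤ dot x ξ}

lemma measurableSet_tcone (J : Finset (Fin m)) (M : ℝ) :
    MeasurableSet (tcone N u k ξ J M) := by
  refine MeasurableSet.inter ?_
    (measurableSet_le measurable_const (continuous_dot' ξ).measurable)
  unfold cone
  simp only [Set.ofPred_forall, Set.ofPred_and]
  refine MeasurableSet.iInter fun j => MeasurableSet.iInter fun _ => MeasurableSet.inter ?_ ?_
  · exact MeasurableSet.iInter fun _ =>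
      measurableSet_lt measurable_const (continuous_dot' _).measurable
  · exact MeasurableSet.iInter fun _ =>
      measurableSet_le (continuous_dot' _).measurable measurable_const

lemma bounded_tcone {J : Finset (Fin m)} (h2 : ∀ x : Fin n → ℝ, x = ∑ j ∈ J, dot x (N j) • u J j)
    (hg : ∀ j ∈ J, dot (u J j) ξ ≠ 0) (M : ℝ) :
    Bornology.IsBounded (tcone N u k ξ J M) := by
  set R := M + dot (vert u k J) ξ with hR
  rw [isBounded_iff_forall_norm_le]
  refine ⟨∑ j ∈ J, (|k j| + R / |dot (u J j) ξ|) * ‖u J j‖, fun x hx => ?_⟩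
  obtain ⟨hxc, hxM⟩ := hx
  have hxM : -M ≤ dot x ξ := hxM
  have hle : ∀ j ∈ J, 0 ≤ -((dot x (N j) - k j) * dot (u J j) ξ) := by
    intro j hj
    have := hxc j hj
    by_cases hc : dot (u J j) ξ < 0
    · have := this.1 hc; nlinarith
    · have := this.2 hc; push Not at hc; nlinarith
  have e : dot x ξ = dot (vert u k J) ξ + ∑ j ∈ J, (dot x (N j) - k j) * dot (u J j) ξ := by
    conv_lhs => rw [h2 x]
    rw [vert, dot_sum_left', dot_sum_left', ← Finset.sum_add_distrib]
    exact Finset.sum_congr rfl fun j _ => by rw [dot_smul_left', dot_smul_left']; ring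
  have hb : ∀ j ∈ J, |dot x (N j)| ≤ |k j| + R / |dot (u J j) ξ| := by
    intro j hj
    have h1 := Finset.single_le_sum hle hj
    rw [Finset.sum_neg_distrib] at h1
    have h3 : |dot x (N j) - k j| * |dot (u J j) ξ| ≤ R := by
      rw [← abs_mul, abs_of_nonpos (by linarith [hle j hj])]
      linarith
    have h4 : |dot x (N j) - k j| ≤ R / |dot (u J j) ξ| :=
      (le_div_iff₀ (abs_pos.2 (hg j hj))).2 h3
    have h5 : |dot x (N j)| ≤ |k j| + |dot x (N j) - k j| := by
      have := abs_add_le (k j) (dot x (N j) - k j)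
      simpa using this
    linarith
  calc ‖x‖ = ‖∑ j ∈ J, dot x (N j) • u J j‖ := by rw [← h2 x]
    _ ≤ ∑ j ∈ J, ‖dot x (N j) • u J j‖ := norm_sum_le _ _
    _ ≤ _ := Finset.sum_le_sum fun j hj => by
      rw [norm_smul, Real.norm_eq_abs]
      exact mul_le_mul_of_nonneg_right (hb j hj) (norm_nonneg _)

lemma integrableOn_of_bounded {s : Set (Fin n → ℝ)} (hs : Bornology.IsBounded s) {f : (Fin n → ℝ) → ℝ}
    (hf : Continuous f) : IntegrableOn f s := by
  have : IsCompact (closure s) := hs.isCompact_closure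
  exact (hf.continuousOn.integrableOn_compact this).mono_set subset_closure

lemma mem_tcone_scale (h : Good N V u k) {J} (hJ : J ∈ V) {M : ℝ}
    (hr : 0 < M + dot (vert u k J) ξ) (y : Fin n → ℝ) :
    vert u k J + (M + dot (vert u k J) ξ) • y ∈ tcone N u k ξ J M ↔
      y ∈ tcone N u 0 ξ J 1 := by
  set r := M + dot (vert u k J) ξ with hrdef
  have e : ∀ j ∈ J, dot (vert u k J + r • y) (N j) = k j + r * dot y (N j) := by
    intro j hj
    rw [dot_add_left', dot_smul_left', h.vert_tight hJ hj]
  refine and_congr (forall₂_congr fun j hj => and_congr (imp_congr_right fun _ => ?_)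
    (imp_congr_right fun _ => ?_)) ?_
  · rw [e j hj]; simp [hr]
  · rw [e j hj]
    simp only [Pi.zero_apply, add_le_iff_nonpos_right]
    constructor
    · intro hh; by_contra hc; push Not at hc; nlinarith [mul_pos hr hc]
    · intro hh; nlinarith
  · change -M ≤ dot (vert u k J + r • y) ξ ↔ -1 ≤ dot y ξ
    rw [dot_add_left', dot_smul_left']
    constructor
    · intro hh; by_contra hc; push Not at hc; nlinarith
    · intro hh; nlinarith

lemma integral_tcone (h : Good N V u k) (hξ : Generic V u ξ) {J} (hJ : J ∈ V) {M : ℝ}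
    (hr : 0 < M + dot (vert u k J) ξ) (b : Fin n → ℝ) :
    ∫ x in tcone N u k ξ J M, dot x b = (M + dot (vert u k J) ξ) ^ n *
      (dot (vert u k J) b * (∫ x in tcone N u 0 ξ J 1, (1:ℝ)) +
        (M + dot (vert u k J) ξ) * ∫ x in tcone N u 0 ξ J 1, dot x b) := by
  have hmem := mem_tcone_scale h hJ hr
  set r := M + dot (vert u k J) ξ with hrdef
  set v := vert u k J
  set S := tcone N u 0 ξ J 1 with hS
  have hSm : MeasurableSet S := measurableSet_tcone J 1
  have hSb : Bornology.IsBounded S := bounded_tcone (h.h2 J hJ) (hξ J hJ) 1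
  rw [← integral_indicator (measurableSet_tcone J M)]
  set g := (tcone N u k ξ J M).indicator fun x => dot x b with hg
  rw [← integral_add_left_eq_self g v]
  have e1 := Measure.integral_comp_smul (volume : Measure (Fin n → ℝ)) (fun y => g (v + y)) r
  have e2 : (fun y => g (v + r • y)) = S.indicator fun y => dot v b * 1 + r * dot y b := by
    funext y
    by_cases hy : y ∈ S
    · rw [Set.indicator_of_mem hy, hg, Set.indicator_of_mem ((hmem y).2 hy), dot_add_left',
        dot_smul_left', mul_one]
    · rw [Set.indicator_of_notMem hy, hg, Set.indicator_of_notMem (fun hh => hy ((hmem y).1 hh))]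
  have e3 : ∫ y, g (v + r • y) = dot v b * (∫ x in S, (1:ℝ)) + r * ∫ x in S, dot x b := by
    rw [e2, integral_indicator hSm, integral_add, integral_const_mul, integral_const_mul]
    · exact (integrableOn_of_bounded hSb continuous_const).const_mul _
    · exact (integrableOn_of_bounded hSb (continuous_dot' b)).const_mul _
  rw [← e3, e1]
  have hrn : 0 < r ^ n := pow_pos hr n
  simp only [Module.finrank_fin_fun, smul_eq_mul]
  rw [abs_of_pos (inv_pos.2 hrn), ← mul_assoc, mul_inv_cancel₀ hrn.ne', one_mul]

lemma Good.integral_trunc (h : Good N V u k) (hξ : Generic V u ξ) (b : Fin n → ℝ) {M : ℝ}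
    (hM : ∀ x ∈ PolyDelta N k, -M ≤ dot x ξ) :
    ∫ x in PolyDelta N k, dot x b =
      ∑ J ∈ V, sgn u ξ J * ∫ x in tcone N u k ξ J M, dot x b := by
  classical
  have hDm : MeasurableSet (PolyDelta N k) := h.hc.isClosed.measurableSet
  rw [← integral_indicator hDm]
  have e : (PolyDelta N k).indicator (fun x => dot x b) = fun x =>
      ∑ J ∈ V, sgn u ξ J * (tcone N u k ξ J M).indicator (fun x => dot x b) x := by
    funext x
    have hi := h.indicator hξ x
    by_cases hxM : -M ≤ dot x ξ
    · have : ∀ J ∈ V, sgn u ξ J * (tcone N u k ξ J M).indicator (fun x => dot x b) x =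
          (if x ∈ cone N u k ξ J then sgn u ξ J else 0) * dot x b := by
        intro J _
        by_cases hx : x ∈ cone N u k ξ J
        · rw [Set.indicator_of_mem (show x ∈ tcone N u k ξ J M from ⟨hx, hxM⟩), if_pos hx]
        · rw [Set.indicator_of_notMem (fun hh => hx hh.1), if_neg hx]; simp
      rw [Finset.sum_congr rfl this, ← Finset.sum_mul, hi]
      by_cases hx : x ∈ PolyDelta N k <;> simp [hx]
    · rw [Set.indicator_of_notMem (fun hh => hxM (hM x hh))]
      refine (Finset.sum_eq_zero fun J _ => ?_).symm
      rw [Set.indicator_of_notMem (fun hh => hxM hh.2), mul_zero]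
  rw [e, integral_finsetSum]
  · refine Finset.sum_congr rfl fun J _ => ?_
    rw [integral_const_mul, integral_indicator (measurableSet_tcone J M)]
  · intro J hJ
    refine Integrable.const_mul ?_ _
    rw [integrable_indicator_iff (measurableSet_tcone J M)]
    exact integrableOn_of_bounded (bounded_tcone (h.h2 J hJ) (hξ J hJ) M) (continuous_dot' b)

lemma Good.integral_eq (h : Good N V u k) (hξ : Generic V u ξ) (b : Fin n → ℝ) :
    ∫ x in PolyDelta N k, dot x b =
      ∑ J ∈ V, sgn u ξ J * ((dot (vert u k J) ξ) ^ n *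
      (dot (vert u k J) b * (∫ x in tcone N u 0 ξ J 1, (1:ℝ)) +
        (dot (vert u k J) ξ) * ∫ x in tcone N u 0 ξ J 1, dot x b)) := by
  obtain ⟨C, hC⟩ := (h.hc.image (continuous_dot' ξ)).bddBelow
  have hC' : ∀ x ∈ PolyDelta N k, C ≤ dot x ξ := fun x hx => hC ⟨x, hx, rfl⟩
  let P : Polynomial ℝ := ∑ J ∈ V, Polynomial.C (sgn u ξ J) *
    ((Polynomial.X + Polynomial.C (dot (vert u k J) ξ)) ^ n *
      (Polynomial.C (dot (vert u k J) b * (∫ x in tcone N u 0 ξ J 1, (1:ℝ))) +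
        (Polynomial.X + Polynomial.C (dot (vert u k J) ξ)) *
          Polynomial.C (∫ x in tcone N u 0 ξ J 1, dot x b)))
  have hP : ∀ M, P.eval M = ∑ J ∈ V, sgn u ξ J * ((M + dot (vert u k J) ξ) ^ n *
      (dot (vert u k J) b * (∫ x in tcone N u 0 ξ J 1, (1:ℝ)) +
        (M + dot (vert u k J) ξ) * ∫ x in tcone N u 0 ξ J 1, dot x b)) := by
    intro M
    simp only [P, Polynomial.eval_finsetSum, Polynomial.eval_mul, Polynomial.eval_pow,
      Polynomial.eval_add, Polynomial.eval_C, Polynomial.eval_X]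
  have hPC : P = Polynomial.C (∫ x in PolyDelta N k, dot x b) := by
    apply Polynomial.eq_of_infinite_eval_eq
    refine (Set.Ioi_infinite (-C)).mono fun M hM => ?_
    have hM : -C < M := hM
    change P.eval M = (Polynomial.C _).eval M
    rw [hP, Polynomial.eval_C,
      h.integral_trunc hξ b (M := M) (fun x hx => by linarith [hC' x hx])]
    refine Finset.sum_congr rfl fun J hJ => ?_
    have := hC' _ (h.h5 J hJ)
    rw [integral_tcone h hξ hJ (by change C ≤ dot (vert u k J) ξ at this; linarith) b]
  have h0 := hP 0
  rw [hPC, Polynomial.eval_C] at h0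
  simpa only [zero_add] using h0

open MvPolynomial in
lemma exists_poly (hgood : ∃ k0, Good N V u k0) (b : Fin n → ℝ) :
    ∃ Q : MvPolynomial (Fin m) ℝ, Q.IsHomogeneous (n + 1) ∧
      ∀ k, Good N V u k → (∫ x in PolyDelta N k, dot x b) = MvPolynomial.eval k Q := by
  obtain ⟨k0, hk0⟩ := hgood
  obtain ⟨ξ, hξ⟩ := exists_generic hk0.u_ne
  let L : Finset (Fin m) → (Fin n → ℝ) → MvPolynomial (Fin m) ℝ := fun J z =>
    ∑ j ∈ J, C (dot (u J j) z) * X j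
  have hL : ∀ J z, (L J z).IsHomogeneous 1 := fun J z =>
    IsHomogeneous.sum _ _ _ fun j _ => by
      simpa using (isHomogeneous_C (Fin m) (dot (u J j) z)).mul (isHomogeneous_X ℝ j)
  have hLe : ∀ k J z, eval k (L J z) = dot (vert u k J) z := by
    intro k J z
    simp only [L, map_sum, map_mul, eval_C, eval_X, vert, dot_sum_left', dot_smul_left']
    exact Finset.sum_congr rfl fun j _ => mul_comm _ _
  have hCm : ∀ (p : MvPolynomial (Fin m) ℝ) (d : ℕ) (c : ℝ), p.IsHomogeneous d →
      (C c * p).IsHomogeneous d := fun p d c hp => by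
    simpa using (isHomogeneous_C (Fin m) c).mul hp
  refine ⟨∑ J ∈ V, C (sgn u ξ J) * ((L J ξ) ^ n *
      (C (∫ x in tcone N u 0 ξ J 1, (1:ℝ)) * L J b +
        C (∫ x in tcone N u 0 ξ J 1, dot x b) * L J ξ)), ?_, ?_⟩
  · refine IsHomogeneous.sum _ _ _ fun J _ => hCm _ _ _ ?_
    refine IsHomogeneous.mul ?_ ((hCm _ _ _ (hL J b)).add (hCm _ _ _ (hL J ξ)))
    simpa using (hL J ξ).pow n
  · intro k hk
    rw [hk.integral_eq hξ b]
    simp only [map_sum, map_mul, map_add, map_pow, eval_C, hLe]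
    exact Finset.sum_congr rfl fun J _ => by ring

end

lemma compact_of_compact {n m : ℕ} (N : Fin m → Fin n → ℝ) (k0 k : Fin m → ℝ)
    (hcpt : IsCompact (PolyDelta N k0)) (hne : (PolyDelta N k0).Nonempty) :
    IsCompact (PolyDelta N k) := by
  have hclosed : IsClosed (PolyDelta N k) := by
    unfold PolyDelta
    simp only [Set.ofPred_forall]
    exact isClosed_iInter fun j => isClosed_le (continuous_dot' _) continuous_const
  refine Metric.isCompact_of_isClosed_isBounded hclosed ?_
  let g : (Fin n → ℝ) → ℝ := fun y => ∑ j, max 0 (dot y (N j))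
  have hgc : Continuous g :=
    continuous_finsetSum _ fun j _ => continuous_const.max (continuous_dot' _)
  have hsph : IsCompact (Metric.sphere (0 : Fin n → ℝ) 1) := isCompact_sphere _ _
  have hgpos : ∀ y ∈ Metric.sphere (0 : Fin n → ℝ) 1, 0 < g y := by
    intro y hy
    have hy1 : ‖y‖ = 1 := by simpa using hy
    have h0 : 0 ≤ g y := Finset.sum_nonneg fun j _ => le_max_left _ _
    refine lt_of_le_of_ne h0 fun h => ?_
    have hle : ∀ j, dot y (N j) ≤ 0 := by
      intro j
      have := (Finset.sum_eq_zero_iff_of_nonneg (fun j _ => le_max_left 0 (dot y (N j)))).1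
        h.symm j (Finset.mem_univ j)
      have h2 := le_max_right 0 (dot y (N j))
      linarith
    obtain ⟨x, hx⟩ := hne
    obtain ⟨B, hB⟩ := isBounded_iff_forall_norm_le.1 hcpt.isBounded
    have hmem : x + (B + ‖x‖ + 1) • y ∈ PolyDelta N k0 := by
      intro j
      rw [dot_add_left', dot_smul_left']
      have h3 := hx j
      have h4 := hB x hx
      have h5 := norm_nonneg x
      nlinarith [hle j]
    have h6 := hB _ hmem
    have h7 : ‖(B + ‖x‖ + 1) • y‖ = B + ‖x‖ + 1 := by
      rw [norm_smul, hy1, mul_one, Real.norm_eq_abs, abs_of_nonneg]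
      linarith [hB x hx, norm_nonneg x]
    have h8 := norm_sub_le (x + (B + ‖x‖ + 1) • y) x
    rw [add_sub_cancel_left, h7] at h8
    linarith
  have hδ : ∃ δ : ℝ, 0 < δ ∧ ∀ y ∈ Metric.sphere (0 : Fin n → ℝ) 1, δ ≤ g y := by
    by_cases hs : (Metric.sphere (0 : Fin n → ℝ) 1).Nonempty
    · obtain ⟨y, hy, hmin⟩ := hsph.exists_isMinOn hs hgc.continuousOn
      exact ⟨g y, hgpos y hy, fun z hz => hmin hz⟩
    · exact ⟨1, one_pos, fun y hy => absurd ⟨y, hy⟩ hs⟩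
  obtain ⟨δ, hδ, hδ2⟩ := hδ
  rw [isBounded_iff_forall_norm_le]
  refine ⟨(∑ j, |k j|) / δ, fun x hx => ?_⟩
  rw [le_div_iff₀ hδ]
  by_cases hx0 : x = 0
  · rw [hx0]; simp; exact Finset.sum_nonneg fun j _ => abs_nonneg _
  have hxn : 0 < ‖x‖ := norm_pos_iff.2 hx0
  have h1 := hδ2 (‖x‖⁻¹ • x) (by simp [norm_smul, hxn.ne'])
  have h2 : ‖x‖ * g (‖x‖⁻¹ • x) = g x := by
    simp only [g, Finset.mul_sum]
    refine Finset.sum_congr rfl fun j _ => ?_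
    rw [dot_smul_left', mul_max_of_nonneg _ _ hxn.le, mul_zero, ← mul_assoc,
      mul_inv_cancel₀ hxn.ne', one_mul]
  have h3 : g x ≤ ∑ j, |k j| := Finset.sum_le_sum fun j _ =>
    max_le (abs_nonneg _) ((hx j).trans (le_abs_self _))
  calc ‖x‖ * δ ≤ ‖x‖ * g (‖x‖⁻¹ • x) := mul_le_mul_of_nonneg_left h1 hxn.le
    _ ≤ _ := by rw [h2]; exact h3

lemma exists_vertex {n m : ℕ} (N : Fin m → Fin n → ℝ) (k0 : Fin m → ℝ)
    (hcpt : IsCompact (PolyDelta N k0)) (S : Finset (Fin m)) {x : Fin n → ℝ}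
    (hx : x ∈ PolyDelta N k0) (hxS : ∀ j ∈ S, dot x (N j) = k0 j) :
    ∃ v ∈ Set.extremePoints ℝ (PolyDelta N k0), ∀ j ∈ S, dot v (N j) = k0 j := by
  let F : Set (Fin n → ℝ) := PolyDelta N k0 ∩ {x | ∀ j ∈ S, dot x (N j) = k0 j}
  have hFc : IsCompact F := by
    apply hcpt.inter_right
    simp only [Set.ofPred_forall]
    exact isClosed_iInter fun j => isClosed_iInter fun _ =>
      isClosed_eq (continuous_dot' _) continuous_const
  obtain ⟨v, hv⟩ := hFc.extremePoints_nonempty ⟨x, hx, hxS⟩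
  have hext : IsExtreme ℝ (PolyDelta N k0) F := by
    refine ⟨Set.inter_subset_left, fun a ha c hc z hz hzs => ⟨ha, fun j hj => ?_⟩⟩
    obtain ⟨s, t, hs, ht, hst, rfl⟩ := hzs
    have h1 := hz.2 j hj
    rw [dot_add_left', dot_smul_left', dot_smul_left'] at h1
    have h2 := ha j
    have h3 := hc j
    by_contra hne
    have h4 : dot a (N j) < k0 j := lt_of_le_of_ne h2 hne
    have : k0 j = s * k0 j + t * k0 j := by rw [← add_mul, hst, one_mul]
    nlinarith [mul_lt_mul_of_pos_left h4 hs, mul_le_mul_of_nonneg_left h3 ht.le]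
  exact ⟨v, hext.extremePoints_subset_extremePoints hv, hv.1.2⟩

lemma exists_dual {n m : ℕ} (N : Fin m → Fin n → ℝ) (J : Finset (Fin m)) (hJ : J.card = n)
    (e : Fin n → Fin m) (he : ∀ i, e i ∈ J) (hinj : Function.Injective e)
    (hdet : |(Matrix.of fun i i' => N (e i) i').det| = 1) :
    ∃ w : Fin m → Fin n → ℝ,
      (∀ i ∈ J, ∀ j ∈ J, dot (w i) (N j) = if i = j then 1 else 0) ∧
      ∀ x : Fin n → ℝ, x = ∑ j ∈ J, dot x (N j) • w j := by
  classical
  have himg : J = Finset.univ.image e := by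
    symm
    apply Finset.eq_of_subset_of_card_le
    · intro j hj
      obtain ⟨i, -, rfl⟩ := Finset.mem_image.1 hj
      exact he i
    · rw [hJ, Finset.card_image_of_injective _ hinj]; simp
  set A : Matrix (Fin n) (Fin n) ℝ := Matrix.of fun i i' => N (e i) i' with hA
  have hu : IsUnit A.det := by
    rw [isUnit_iff_ne_zero]
    intro h0; rw [h0] at hdet; simp at hdet
  let w : Fin m → Fin n → ℝ := Function.extend e (fun i i' => A⁻¹ i' i) 0
  have hw : ∀ i, w (e i) = fun i' => A⁻¹ i' i := fun i => hinj.extend_apply _ _ i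
  refine ⟨w, ?_, ?_⟩
  · intro a ha c hc
    rw [himg] at ha hc
    obtain ⟨i, -, rfl⟩ := Finset.mem_image.1 ha
    obtain ⟨j, -, rfl⟩ := Finset.mem_image.1 hc
    have h1 := congrFun (congrFun (Matrix.mul_nonsing_inv A hu) j) i
    rw [Matrix.mul_apply, Matrix.one_apply] at h1
    rw [hw, dot]
    simp only [hinj.eq_iff]
    rw [show (if i = j then (1:ℝ) else 0) = if j = i then 1 else 0 by simp [eq_comm], ← h1]
    exact Finset.sum_congr rfl fun l _ => by rw [mul_comm]; rfl
  · intro x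
    rw [himg, Finset.sum_image fun a _ b _ h => hinj h]
    ext l
    have h1 : A⁻¹.mulVec (A.mulVec x) = x := by
      rw [Matrix.mulVec_mulVec, Matrix.nonsing_inv_mul A hu, Matrix.one_mulVec]
    conv_lhs => rw [← h1]
    rw [Matrix.mulVec, dotProduct, Finset.sum_apply]
    refine Finset.sum_congr rfl fun i _ => ?_
    rw [Pi.smul_apply, hw, smul_eq_mul, mul_comm]
    congr 1
    rw [Matrix.mulVec, dotProduct, dot]
    exact Finset.sum_congr rfl fun l _ => by rw [mul_comm]; rfl

lemma mem_faces {n m : ℕ} (N : Fin m → Fin n → ℝ) (k : Fin m → ℝ) (J : Finset (Fin m))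
    (hJ : J.Nonempty) : (⋂ j ∈ J, PolyFacet N k j).Nonempty ↔
      ∃ x ∈ PolyDelta N k, ∀ j ∈ J, dot x (N j) = k j := by
  constructor
  · rintro ⟨x, hx⟩
    simp only [Set.mem_iInter] at hx
    obtain ⟨j, hj⟩ := hJ
    exact ⟨x, (hx j hj).1, fun j hj => (hx j hj).2⟩
  · rintro ⟨x, hx, h⟩
    exact ⟨x, by simp only [Set.mem_iInter]; exact fun j hj => ⟨hx, h j hj⟩⟩

theorem stmt8 {n m : ℕ} (N : Fin m → Fin n → ℝ) (k0 : Fin m → ℝ)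
    (hcpt : IsCompact (PolyDelta N k0)) (hint : (interior (PolyDelta N k0)).Nonempty)
    (hDelzant : IsDelzant N k0) (b : Fin n → ℝ) :
    ∃ Q : MvPolynomial (Fin m) ℝ, Q.IsHomogeneous (n + 1) ∧
      ∀ k ∈ chamber N k0,
        (∫ x in PolyDelta N k, dot x b) = MvPolynomial.eval k Q := by
  classical
  rcases Nat.eq_zero_or_pos n with hn | hn
  · subst hn
    refine ⟨0, MvPolynomial.isHomogeneous_zero _ _ _, fun k _ => ?_⟩
    simp [dot]
  have hne : (PolyDelta N k0).Nonempty := hint.mono interior_subset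
  let V : Finset (Finset (Fin m)) := Finset.univ.filter fun J =>
    ∃ v ∈ Set.extremePoints ℝ (PolyDelta N k0), ∀ j, j ∈ J ↔ dot v (N j) = k0 j
  have hV : ∀ J, J ∈ V ↔ ∃ v ∈ Set.extremePoints ℝ (PolyDelta N k0),
      ∀ j, j ∈ J ↔ dot v (N j) = k0 j := fun J => by simp [V]
  have hex : ∀ J ∈ V, J.card = n ∧ ∃ w : Fin m → Fin n → ℝ,
      (∀ i ∈ J, ∀ j ∈ J, dot (w i) (N j) = if i = j then 1 else 0) ∧
      ∀ x : Fin n → ℝ, x = ∑ j ∈ J, dot x (N j) • w j := by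
    intro J hJ
    obtain ⟨v, hv, hvJ⟩ := (hV J).1 hJ
    obtain ⟨J', hc, hJ', e, he, hinj, hdet⟩ := hDelzant.2 v hv
    have : J' = J := by ext j; rw [hJ', hvJ]
    subst this
    exact ⟨hc, exists_dual N J' hc e he hinj hdet⟩
  have hw : ∀ J, ∃ w : Fin m → Fin n → ℝ, J ∈ V →
      (∀ i ∈ J, ∀ j ∈ J, dot (w i) (N j) = if i = j then 1 else 0) ∧
      ∀ x : Fin n → ℝ, x = ∑ j ∈ J, dot x (N j) • w j := by
    intro J
    by_cases hJ : J ∈ V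
    · obtain ⟨w, hw⟩ := (hex J hJ).2
      exact ⟨w, fun _ => hw⟩
    · exact ⟨0, fun h => absurd h hJ⟩
  choose u hu using hw
  have hface : ∀ (S : Finset (Fin m)) (x : Fin n → ℝ), x ∈ PolyDelta N k0 →
      (∀ j ∈ S, dot x (N j) = k0 j) → ∃ J ∈ V, S ⊆ J := by
    intro S x hx hxS
    obtain ⟨v, hv, hvS⟩ := exists_vertex N k0 hcpt S hx hxS
    refine ⟨Finset.univ.filter fun j => dot v (N j) = k0 j, (hV _).2 ⟨v, hv, by simp⟩, ?_⟩
    intro j hj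
    simpa using hvS j hj
  have hgood : ∀ k ∈ chamber N k0, Good N V u k := by
    intro k hk
    refine ⟨fun J hJ => (hu J hJ).1, fun J hJ => (hu J hJ).2, fun J hJ => (hex J hJ).1, ?_, ?_,
      compact_of_compact N k0 k hcpt hne⟩
    · intro x hx
      have : ∃ J ∈ V, (Finset.univ.filter fun j => dot x (N j) = k j) ⊆ J := by
        rcases (Finset.univ.filter fun j => dot x (N j) = k j).eq_empty_or_nonempty with h0 | h0
        · obtain ⟨y, hy⟩ := hne
          rw [h0]
          exact hface ∅ y hy (by simp)
        · have h1 := (hk _).1 ((mem_faces N k _ h0).2 ⟨x, hx, by simp⟩)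
          obtain ⟨y, hy, hyS⟩ := (mem_faces N k0 _ h0).1 h1
          exact hface _ y hy hyS
      obtain ⟨J, hJ, hsub⟩ := this
      exact ⟨J, hJ, fun j hj => hsub (by simpa using hj)⟩
    · intro J hJ
      have hJne : J.Nonempty := Finset.card_pos.1 (by rw [(hex J hJ).1]; exact hn)
      obtain ⟨v, hv, hvJ⟩ := (hV J).1 hJ
      have h1 := (hk J).2 ((mem_faces N k0 J hJne).2 ⟨v, hv.1, fun j hj => (hvJ j).1 hj⟩)
      obtain ⟨y, hy, hyJ⟩ := (mem_faces N k J hJne).1 h1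
      have h2 := (hu J hJ).2 y
      rw [Finset.sum_congr rfl fun j hj => by rw [hyJ j hj]] at h2
      rw [← h2]
      exact hy
  obtain ⟨Q, hQ, hQ2⟩ := exists_poly ⟨k0, hgood k0 fun J => Iff.rfl⟩ b
  exact ⟨Q, hQ, fun k hk => hQ2 k (hgood k hk)⟩
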